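/- Let ε be a real random variable whose distribution function F has a density f (so F′ = f) such that f is positive, twice differentiable and bounded on the open interval 𝓕 = {x : 0 < F(x) < 1}. Let g(x) = f{F⁻¹(x)} for x ∈ (0,1), where F⁻¹ is the inverse of the restriction of F to 𝓕, and suppose for some ν₃ ∈ [0,∞) that x⁻¹[g(x)² + g(1−x)²] → ν₃ and x² ∫_x^{1−x} g″(t)² dt → 0 as x → 0⁺, with g twice continuously differentiable on (0,1) and ∫_𝓕 f′(t)²/f(t) dt < ∞. For each integer K ≥ 2 set τ_k = k/(K+1), β_k = F⁻¹(τ_k), let H_K be the K×K matrix with (i,j)-th entry {f(β_i)f(β_j)}⁻¹{min(τ_i,τ_j) − τ_i τ_j}, and let r ∈ ℝ^K be the all-ones vector. Then lim_{K→∞} rᵀH_K⁻¹r = ∫_𝓕 f′(t)²/f(t) dt + ν₃. -/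

import Mathlib

open MeasureTheory Filter Matrix

/-- The second difference operator is inverted by the (discrete) Brownian bridge kernel. -/
lemma sum_bridge_mul_second_diff (w : ℕ → ℝ) (K i : ℕ) (hi : i ≤ K) (h0 : w 0 = 0)
    (hK : w (K + 1) = 0) :
    ∑ j ∈ Finset.range K, (min (i : ℝ) (j + 1) - i * (j + 1) / (K + 1)) *
      (2 * w (j + 1) - w j - w (j + 2)) = w i := by
  have hlin : ∀ m : ℕ, ∑ j ∈ Finset.range m, ((j : ℝ) + 1) *
      (2 * w (j + 1) - w j - w (j + 2)) = (m + 1) * w m - m * w (m + 1) := by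
    intro m
    induction m with
    | zero => simp [h0]
    | succ m ih => rw [Finset.sum_range_succ, ih]; push_cast; ring
  have hmin : ∀ m : ℕ, ∑ j ∈ Finset.range (i + m), min (i : ℝ) (j + 1) *
      (2 * w (j + 1) - w j - w (j + 2)) = w i + i * w (i + m) - i * w (i + m + 1) := by
    intro m
    induction m with
    | zero =>
      have : ∑ j ∈ Finset.range i, min (i : ℝ) (j + 1) * (2 * w (j + 1) - w j - w (j + 2)) =
          ∑ j ∈ Finset.range i, ((j : ℝ) + 1) * (2 * w (j + 1) - w j - w (j + 2)) := by
        refine Finset.sum_congr rfl fun j hj => ?_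
        rw [min_eq_right]
        exact_mod_cast Finset.mem_range.1 hj
      rw [add_zero, this, hlin]; ring
    | succ m ih =>
      rw [← add_assoc, Finset.sum_range_succ, ih, min_eq_left (by push_cast; linarith)]
      ring
  have hm := hmin (K - i)
  rw [Nat.add_sub_cancel' hi, hK] at hm
  have hl := hlin K
  rw [hK] at hl
  have hn : (K : ℝ) + 1 ≠ 0 := by positivity
  have : ∑ j ∈ Finset.range K, (min (i : ℝ) (j + 1) - i * (j + 1) / (K + 1)) *
      (2 * w (j + 1) - w j - w (j + 2)) =
      ∑ j ∈ Finset.range K, min (i : ℝ) (j + 1) * (2 * w (j + 1) - w j - w (j + 2)) -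
      i / (K + 1) * ∑ j ∈ Finset.range K, ((j : ℝ) + 1) *
        (2 * w (j + 1) - w j - w (j + 2)) := by
    rw [Finset.mul_sum, ← Finset.sum_sub_distrib]
    refine Finset.sum_congr rfl fun j _ => ?_
    ring
  rw [this, hm, hl]
  field_simp
  ring

lemma sum_mul_second_diff (d : ℕ → ℝ) (h0 : d 0 = 0) (m : ℕ) :
    ∑ j ∈ Finset.range m, d (j + 1) * (2 * d (j + 1) - d j - d (j + 2)) =
      ∑ j ∈ Finset.range m, (d (j + 1) - d j) ^ 2 + d m * (d m - d (m + 1)) := by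
  induction m with
  | zero => simp [h0]
  | succ m ih => rw [Finset.sum_range_succ, ih, Finset.sum_range_succ]; ring

/-- The quadratic form of the inverse of a rescaled Brownian bridge covariance matrix at the
all-ones vector. -/
lemma ones_dotProduct_inv_bridge (m : ℕ) (d : ℕ → ℝ) (hd0 : d 0 = 0) (hdm : d (m + 2) = 0)
    (hd : ∀ i ≤ m, d (i + 1) ≠ 0) (H : Matrix (Fin (m + 1)) (Fin (m + 1)) ℝ)
    (hH : ∀ i j : Fin (m + 1), H i j = (d (i + 1) * d (j + 1))⁻¹ *
      (min (((i : ℕ) + 1 : ℝ) / (m + 2)) (((j : ℕ) + 1 : ℝ) / (m + 2)) -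
        (((i : ℕ) + 1 : ℝ) / (m + 2)) * (((j : ℕ) + 1 : ℝ) / (m + 2)))) :
    (fun _ => (1 : ℝ)) ⬝ᵥ H⁻¹.mulVec (fun _ => 1) =
      (m + 2) * (d 1 ^ 2 + d (m + 1) ^ 2) +
        (m + 2) * ∑ j ∈ Finset.range m, (d (j + 2) - d (j + 1)) ^ 2 := by
  have hn : (m : ℝ) + 2 ≠ 0 := by positivity
  have key : ∀ w : ℕ → ℝ, w 0 = 0 → w (m + 2) = 0 →
      H.mulVec (fun j => d (j + 1) * ((m + 2) * (2 * w (j + 1) - w j - w (j + 2)))) =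
        fun i : Fin (m + 1) => w (i + 1) / d (i + 1) := by
    intro w hw0 hwm
    ext i
    have hdi := hd i (by omega)
    have h := sum_bridge_mul_second_diff w (m + 1) (i + 1) (by omega) hw0 hwm
    rw [← h, Matrix.mulVec, dotProduct, ← Fin.sum_univ_eq_sum_range
      (fun j => (min (((i : ℕ) + 1 : ℕ) : ℝ) (j + 1) - (((i : ℕ) + 1 : ℕ) : ℝ) * (j + 1) /
        (((m + 1 : ℕ) : ℝ) + 1)) * (2 * w (j + 1) - w j - w (j + 2))) (m + 1), Finset.sum_div]
    refine Finset.sum_congr rfl fun j _ => ?_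
    have hdj := hd j (by omega)
    rw [hH, min_div_div_right (by positivity)]
    push_cast
    have e : (m : ℝ) + 1 + 1 = m + 2 := by ring
    rw [e]
    field_simp
  have hu : IsUnit H := by
    rw [← Matrix.mulVec_surjective_iff_isUnit]
    intro y
    refine ⟨_, (key (fun k => if h : 0 < k ∧ k < m + 2 then
      d k * y ⟨k - 1, by omega⟩ else 0) (by simp) (by simp)).trans ?_⟩
    ext i
    have hdi := hd i (by omega)
    have hile : (i : ℕ) ≤ m := by omega
    simp [hile, hdi]
  have hone := key d hd0 hdm
  have hone' : (fun i : Fin (m + 1) => d (i + 1) / d (i + 1)) = fun _ => (1 : ℝ) := by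
    ext i
    exact div_self (hd i (by omega))
  rw [hone'] at hone
  have hv : H⁻¹.mulVec (fun _ => 1) =
      fun j : Fin (m + 1) => d (j + 1) * ((m + 2) * (2 * d (j + 1) - d j - d (j + 2))) := by
    rw [← hone, Matrix.mulVec_mulVec, Matrix.nonsing_inv_mul _ (H.isUnit_iff_isUnit_det.1 hu),
      Matrix.one_mulVec]
  rw [hv, dotProduct]
  simp only [one_mul]
  rw [Fin.sum_univ_eq_sum_range
    (fun j => d (j + 1) * ((m + 2) * (2 * d (j + 1) - d j - d (j + 2)))) (m + 1)]
  have : ∑ j ∈ Finset.range (m + 1), d (j + 1) * ((m + 2) * (2 * d (j + 1) - d j - d (j + 2))) =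
      (m + 2) * ∑ j ∈ Finset.range (m + 1), d (j + 1) * (2 * d (j + 1) - d j - d (j + 2)) := by
    rw [Finset.mul_sum]
    exact Finset.sum_congr rfl fun j _ => by ring
  rw [this, sum_mul_second_diff d hd0, Finset.sum_range_succ', hdm, hd0]
  simp only [zero_add]
  ring

lemma sq_sub_le_mul_integral_deriv_sq {g g' : ℝ → ℝ} {a b : ℝ} (hab : a ≤ b)
    (hg : ∀ x ∈ Set.Icc a b, HasDerivAt g (g' x) x) (hc : ContinuousOn g' (Set.Icc a b)) :
    (g b - g a) ^ 2 ≤ (b - a) * ∫ x in a..b, g' x ^ 2 := by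
  rcases hab.eq_or_lt with rfl | hlt
  · simp
  rw [← Set.uIcc_of_le hab] at hg hc
  have hi : IntervalIntegrable g' volume a b := hc.intervalIntegrable
  have hi2 : IntervalIntegrable (fun x => g' x ^ 2) volume a b :=
    (hc.pow 2).intervalIntegrable
  have hftc := intervalIntegral.integral_eq_sub_of_hasDerivAt hg hi
  set c := (g b - g a) / (b - a) with hcdef
  have hba : b - a ≠ 0 := sub_ne_zero.2 hlt.ne'
  have hnn : 0 ≤ ∫ x in a..b, (g' x - c) ^ 2 :=
    intervalIntegral.integral_nonneg hab fun x _ => sq_nonneg _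
  have he : ∫ x in a..b, (g' x - c) ^ 2 =
      (∫ x in a..b, g' x ^ 2) - 2 * c * (g b - g a) + c ^ 2 * (b - a) := by
    have : (fun x => (g' x - c) ^ 2) = fun x => (g' x ^ 2 - 2 * c * g' x) + c ^ 2 := by
      ext x; ring
    rw [this, intervalIntegral.integral_add (hi2.sub (hi.const_mul _)) (by simp),
      intervalIntegral.integral_sub hi2 (hi.const_mul _), intervalIntegral.integral_const_mul,
      hftc, intervalIntegral.integral_const, smul_eq_mul]
    ring
  have hcm : c * (b - a) = g b - g a := div_mul_cancel₀ _ hba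
  rw [he] at hnn
  have := mul_nonneg (sub_nonneg.2 hab) hnn
  rw [← hcm] at this ⊢
  nlinarith

lemma grid_mem_Ioo {m j : ℕ} (hj : j ≤ m) :
    ((j : ℝ) + 1) / (m + 2) ∈ Set.Ioo (0 : ℝ) 1 := by
  have : (j : ℝ) ≤ m := by exact_mod_cast hj
  constructor
  · positivity
  · rw [div_lt_one (by positivity)]; linarith

lemma grid_Icc_subset {m j : ℕ} (hj : j < m) :
    Set.Icc (((j : ℝ) + 1) / (m + 2)) (((j : ℝ) + 2) / (m + 2)) ⊆ Set.Ioo (0 : ℝ) 1 := by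
  have h1 := grid_mem_Ioo hj.le
  have h2 := grid_mem_Ioo (Nat.succ_le_of_lt hj)
  have e : (((j + 1 : ℕ) : ℝ) + 1) = j + 2 := by push_cast; ring
  rw [Nat.succ_eq_add_one, e] at h2
  exact fun x hx => ⟨h1.1.trans_le hx.1, hx.2.trans_lt h2.2⟩

lemma sum_sq_diff_le_integral {g g' : ℝ → ℝ}
    (hg : ∀ x ∈ Set.Ioo (0 : ℝ) 1, HasDerivAt g (g' x) x)
    (hc : ContinuousOn g' (Set.Ioo 0 1))
    (hint : IntegrableOn (fun x => g' x ^ 2) (Set.Ioo 0 1)) (m : ℕ) :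
    (m + 2) * ∑ j ∈ Finset.range m,
      (g (((j : ℝ) + 2) / (m + 2)) - g (((j : ℝ) + 1) / (m + 2))) ^ 2 ≤
      ∫ x in Set.Ioo (0 : ℝ) 1, g' x ^ 2 := by
  have hn : (0 : ℝ) < m + 2 := by positivity
  have hle : ∀ j : ℕ, ((j : ℝ) + 1) / (m + 2) ≤ ((j : ℝ) + 2) / (m + 2) := fun j => by
    gcongr; norm_num
  have hcell : ∀ j ∈ Finset.range m,
      (m + 2) * (g (((j : ℝ) + 2) / (m + 2)) - g (((j : ℝ) + 1) / (m + 2))) ^ 2 ≤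
      ∫ x in (((j : ℝ) + 1) / (m + 2))..(((j : ℝ) + 2) / (m + 2)), g' x ^ 2 := by
    intro j hj
    have hsub := grid_Icc_subset (Finset.mem_range.1 hj)
    have h := sq_sub_le_mul_integral_deriv_sq (hle j) (fun x hx => hg x (hsub hx)) (hc.mono hsub)
    have e : ((j : ℝ) + 2) / (m + 2) - ((j : ℝ) + 1) / (m + 2) = 1 / (m + 2) := by ring
    rw [e] at h
    calc _ ≤ (m + 2) * (1 / (m + 2) * ∫ x in (((j : ℝ) + 1) / (m + 2))..(((j : ℝ) + 2) / (m + 2)),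
          g' x ^ 2) := by gcongr
      _ = _ := by field_simp
  rw [Finset.mul_sum]
  refine (Finset.sum_le_sum hcell).trans ?_
  have hadj := intervalIntegral.sum_integral_adjacent_intervals (f := fun x => g' x ^ 2)
    (μ := volume) (a := fun j : ℕ => ((j : ℝ) + 1) / (m + 2)) (n := m) (fun j hj => by
      have e : (((j + 1 : ℕ) : ℝ) + 1) = j + 2 := by push_cast; ring
      simp only [e]
      refine ContinuousOn.intervalIntegrable ?_
      rw [Set.uIcc_of_le (hle j)]
      exact (hc.mono (grid_Icc_subset hj)).pow 2)
  have e : ∀ j : ℕ, (((j + 1 : ℕ) : ℝ) + 1) = j + 2 := fun j => by push_cast; ring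
  simp only [e] at hadj
  rw [hadj, intervalIntegral.integral_of_le (by gcongr; simp)]
  refine setIntegral_mono_set hint (Eventually.of_forall fun x => sq_nonneg _)
    (LE.le.eventuallyLE fun x hx => ?_)
  have h0 := grid_mem_Ioo (Nat.zero_le m)
  exact ⟨h0.1.trans hx.1, hx.2.trans_lt (grid_mem_Ioo le_rfl).2⟩

lemma lintegral_deriv_sq_le_liminf {g g' : ℝ → ℝ}
    (hg : ∀ x ∈ Set.Ioo (0 : ℝ) 1, HasDerivAt g (g' x) x)
    (hc : ContinuousOn g' (Set.Ioo 0 1)) :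
    ∫⁻ x in Set.Ioo (0 : ℝ) 1, ENNReal.ofReal (g' x ^ 2) ≤
      liminf (fun m : ℕ => ENNReal.ofReal ((m + 2) * ∑ j ∈ Finset.range m,
        (g (((j : ℝ) + 2) / (m + 2)) - g (((j : ℝ) + 1) / (m + 2))) ^ 2)) atTop := by
  let D : ℕ → ℕ → ℝ := fun m j =>
    ((m + 2) * (g (((j : ℝ) + 2) / (m + 2)) - g (((j : ℝ) + 1) / (m + 2)))) ^ 2
  let φ : ℕ → ℝ → ENNReal := fun m x => ∑ j ∈ Finset.range m,
    (Set.Ico (((j : ℝ) + 1) / (m + 2)) (((j : ℝ) + 2) / (m + 2))).indicator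
      (fun _ => ENNReal.ofReal (D m j)) x
  have hφm : ∀ m, Measurable (φ m) := fun m =>
    Finset.measurable_sum _ fun j _ => measurable_const.indicator measurableSet_Ico
  have hφint : ∀ m, ∫⁻ x, φ m x = ENNReal.ofReal ((m + 2) * ∑ j ∈ Finset.range m,
        (g (((j : ℝ) + 2) / (m + 2)) - g (((j : ℝ) + 1) / (m + 2))) ^ 2) := by
    intro m
    rw [lintegral_finsetSum _ fun j _ => measurable_const.indicator measurableSet_Ico,
      Finset.mul_sum, ENNReal.ofReal_sum_of_nonneg fun j _ => by positivity]
    refine Finset.sum_congr rfl fun j _ => ?_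
    rw [lintegral_indicator_const measurableSet_Ico, Real.volume_Ico,
      ← ENNReal.ofReal_mul (sq_nonneg _)]
    congr 1
    have hn : (m : ℝ) + 2 ≠ 0 := by positivity
    field_simp
    ring
  have hpt : ∀ t ∈ Set.Ioo (0 : ℝ) 1,
      ENNReal.ofReal (g' t ^ 2) ≤ liminf (fun m => φ m t) atTop := by
    intro t ht
    refine le_of_forall_lt fun b hb => ?_
    obtain ⟨b', hbb', hb'⟩ := exists_between hb
    refine hbb'.trans_le (le_liminf_of_le (by isBoundedDefault) ?_)
    have hcont : ContinuousAt (fun x => ENNReal.ofReal (g' x ^ 2)) t :=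
      ENNReal.continuous_ofReal.continuousAt.comp
        ((hc.continuousAt (isOpen_Ioo.mem_nhds ht)).pow 2)
    obtain ⟨δ, hδ, hball⟩ := Metric.eventually_nhds_iff.1 (hcont.eventually_const_lt hb')
    have hlarge : ∀ r : ℝ, ∀ᶠ m : ℕ in atTop, r ≤ (m : ℝ) :=
      fun r => tendsto_natCast_atTop_atTop.eventually_ge_atTop r
    filter_upwards [hlarge (1 / δ), hlarge (1 / t), hlarge (2 / (1 - t))] with m h1 h2 h3
    have ht1 : 0 < 1 - t := sub_pos.2 ht.2
    have hn : (0 : ℝ) < m + 2 := by positivity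
    rw [div_le_iff₀ hδ] at h1
    rw [div_le_iff₀ ht.1] at h2
    rw [div_le_iff₀ ht1] at h3
    have ht0 := ht.1
    obtain ⟨j, hj⟩ : ∃ j, ⌊((m : ℝ) + 2) * t⌋₊ = j + 1 := by
      refine Nat.exists_eq_succ_of_ne_zero (Nat.pos_iff_ne_zero.1 (Nat.floor_pos.2 ?_))
      nlinarith
    have hlo := Nat.floor_le (show 0 ≤ ((m : ℝ) + 2) * t by positivity)
    have hhi := Nat.lt_floor_add_one (((m : ℝ) + 2) * t)
    rw [hj] at hlo hhi
    push_cast at hlo hhi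
    have hjm : j < m := by
      have : (j : ℝ) < m := by nlinarith
      exact_mod_cast this
    have hlt : ((j : ℝ) + 1) / (m + 2) < ((j : ℝ) + 2) / (m + 2) := by
      gcongr; norm_num
    have hsub := grid_Icc_subset hjm
    obtain ⟨ξ, hξ, hξe⟩ := exists_hasDerivAt_eq_slope g g' hlt
      (fun x hx => (hg x (hsub hx)).continuousAt.continuousWithinAt)
      (fun x hx => hg x (hsub (Set.Ioo_subset_Icc_self hx)))
    have htm : t ∈ Set.Ico (((j : ℝ) + 1) / (m + 2)) (((j : ℝ) + 2) / (m + 2)) := by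
      constructor
      · rw [div_le_iff₀ hn]; linarith
      · rw [lt_div_iff₀ hn]; linarith
    have e : ((j : ℝ) + 2) / (m + 2) - ((j : ℝ) + 1) / (m + 2) = 1 / (m + 2) := by ring
    have hdist : dist ξ t < δ := by
      have hδ' : 1 / ((m : ℝ) + 2) < δ := by rw [div_lt_iff₀ hn]; nlinarith
      rw [Real.dist_eq, abs_lt]
      constructor <;> linarith [hξ.1, hξ.2, htm.1, htm.2]
    have hD : D m j = g' ξ ^ 2 := by
      rw [hξe, e]
      simp only [D]
      field_simp
    refine (hball hdist).le.trans ?_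
    rw [← hD]
    refine le_trans (le_of_eq ?_) (Finset.single_le_sum (fun _ _ => zero_le)
      (Finset.mem_range.2 hjm))
    rw [Set.indicator_of_mem htm]
  calc _ ≤ ∫⁻ x in Set.Ioo (0 : ℝ) 1, liminf (fun m => φ m x) atTop :=
        setLIntegral_mono' measurableSet_Ioo hpt
    _ ≤ ∫⁻ x, liminf (fun m => φ m x) atTop := setLIntegral_le_lintegral _ _
    _ ≤ liminf (fun m => ∫⁻ x, φ m x) atTop := lintegral_liminf_le hφm
    _ = _ := by simp only [hφint]

/-- The discrete energy of `g` along equally spaced interior grids converges to `∫ g'²`. -/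
lemma tendsto_discrete_energy {g g' : ℝ → ℝ}
    (hg : ∀ x ∈ Set.Ioo (0 : ℝ) 1, HasDerivAt g (g' x) x)
    (hc : ContinuousOn g' (Set.Ioo 0 1))
    (hint : IntegrableOn (fun x => g' x ^ 2) (Set.Ioo 0 1)) :
    Tendsto (fun m : ℕ => ((m : ℝ) + 2) * ∑ j ∈ Finset.range m,
      (g (((j : ℝ) + 2) / (m + 2)) - g (((j : ℝ) + 1) / (m + 2))) ^ 2) atTop
      (nhds (∫ x in Set.Ioo (0 : ℝ) 1, g' x ^ 2)) := by
  have hlow := lintegral_deriv_sq_le_liminf hg hc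
  rw [← ofReal_integral_eq_lintegral_ofReal hint
    (Eventually.of_forall fun x => sq_nonneg _)] at hlow
  have hT := tendsto_of_le_liminf_of_limsup_le hlow
    (limsup_le_of_le (by isBoundedDefault) (Eventually.of_forall fun m =>
      ENNReal.ofReal_le_ofReal (sum_sq_diff_le_integral hg hc hint m)))
  have h := (ENNReal.tendsto_toReal ENNReal.ofReal_ne_top).comp hT
  rw [ENNReal.toReal_ofReal (integral_nonneg fun x => sq_nonneg _)] at h
  refine h.congr fun m => ?_
  exact ENNReal.toReal_ofReal (by positivity)

open MeasureTheory Filter Matrix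

/-- Theorem 3 of the paper (with `ν₃` finite): for an error variable `ε` with distribution
function `F` and density `f` positive, twice differentiable and bounded on
`𝓕 = {x : 0 < F(x) < 1}`, quantiles `β_k = F⁻¹(k/(K+1))` and the asymptotic covariance
matrix `H_K` with entries `{f(β_i)f(β_j)}⁻¹{min(τ_i,τ_j) − τ_i τ_j}`, under Assumption 9
one has `rᵀ H_K⁻¹ r → ∫_𝓕 f′²/f + ν₃` as `K → ∞`, with `r` the all-ones vector. -/
theorem stmt_8
    {Ω : Type*} [MeasurableSpace Ω] (P : Measure Ω) [IsProbabilityMeasure P]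
    (ε : Ω → ℝ) (hε : Measurable ε)
    (F : ℝ → ℝ) (hF : ∀ x, F x = (P {ω | ε ω ≤ x}).toReal)
    (𝓕 : Set ℝ) (h𝓕 : 𝓕 = {x | 0 < F x ∧ F x < 1})
    (f f' f'' : ℝ → ℝ)
    (hFderiv : ∀ t ∈ 𝓕, HasDerivAt F (f t) t)
    (hfpos : ∀ t ∈ 𝓕, 0 < f t)
    (hfbdd : ∃ M : ℝ, ∀ t ∈ 𝓕, f t ≤ M)
    (hfderiv : ∀ t ∈ 𝓕, HasDerivAt f (f' t) t)
    (hf'deriv : ∀ t ∈ 𝓕, HasDerivAt f' (f'' t) t)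
    (Finv : ℝ → ℝ)
    (hFinv_mem : ∀ x ∈ Set.Ioo (0 : ℝ) 1, Finv x ∈ 𝓕)
    (hFinv_right : ∀ x ∈ Set.Ioo (0 : ℝ) 1, F (Finv x) = x)
    (hFinv_left : ∀ t ∈ 𝓕, Finv (F t) = t)
    (g g' g'' : ℝ → ℝ)
    (hg : ∀ x ∈ Set.Ioo (0 : ℝ) 1, g x = f (Finv x))
    (hgderiv : ∀ x ∈ Set.Ioo (0 : ℝ) 1, HasDerivAt g (g' x) x)
    (hg'deriv : ∀ x ∈ Set.Ioo (0 : ℝ) 1, HasDerivAt g' (g'' x) x)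
    (hg''cont : ContinuousOn g'' (Set.Ioo 0 1))
    (ν₃ : ℝ) (hν₃ : 0 ≤ ν₃)
    (hlim1 : Tendsto (fun x : ℝ => x⁻¹ * ((g x) ^ 2 + (g (1 - x)) ^ 2))
      (nhdsWithin 0 (Set.Ioi 0)) (nhds ν₃))
    (hlim2 : Tendsto (fun x : ℝ => x ^ 2 * ∫ t in Set.Icc x (1 - x), (g'' t) ^ 2)
      (nhdsWithin 0 (Set.Ioi 0)) (nhds 0))
    (hFisher : IntegrableOn (fun t => (f' t) ^ 2 / f t) 𝓕)
    (H : (K : ℕ) → Matrix (Fin K) (Fin K) ℝ)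
    (hH : ∀ K : ℕ, ∀ i j : Fin K,
      H K i j = (f (Finv (((i : ℕ) + 1 : ℝ) / ((K : ℝ) + 1)))
          * f (Finv (((j : ℕ) + 1 : ℝ) / ((K : ℝ) + 1))))⁻¹ *
        (min (((i : ℕ) + 1 : ℝ) / ((K : ℝ) + 1)) (((j : ℕ) + 1 : ℝ) / ((K : ℝ) + 1))
          - (((i : ℕ) + 1 : ℝ) / ((K : ℝ) + 1)) * (((j : ℕ) + 1 : ℝ) / ((K : ℝ) + 1)))) :
    Tendsto (fun K : ℕ => (fun _ : Fin K => (1 : ℝ)) ⬝ᵥ (H K)⁻¹.mulVec (fun _ => 1))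
      atTop (nhds ((∫ t in 𝓕, (f' t) ^ 2 / f t) + ν₃)) := by
  have hFmono : Monotone F := fun x y hxy => by
    rw [hF, hF]
    exact ENNReal.toReal_mono (measure_ne_top _ _) (measure_mono fun ω hω => le_trans hω hxy)
  have h𝓕meas : MeasurableSet 𝓕 := by
    rw [h𝓕]
    exact (measurableSet_lt measurable_const hFmono.measurable).inter
      (measurableSet_lt hFmono.measurable measurable_const)
  have hmem : ∀ t ∈ 𝓕, F t ∈ Set.Ioo (0 : ℝ) 1 := fun t ht => by
    rw [h𝓕] at ht
    exact ht
  have himage : F '' 𝓕 = Set.Ioo 0 1 := by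
    ext x
    constructor
    · rintro ⟨t, ht, rfl⟩
      exact hmem t ht
    · exact fun hx => ⟨Finv x, hFinv_mem x hx, hFinv_right x hx⟩
  have hinj : Set.InjOn F 𝓕 := Set.LeftInvOn.injOn (f₁' := Finv) hFinv_left
  have hscore : ∀ t ∈ 𝓕, f' t = g' (F t) * f t := by
    intro t ht
    have hcomp : HasDerivAt (g ∘ F) (g' (F t) * f t) t :=
      (hgderiv (F t) (hmem t ht)).comp t (hFderiv t ht)
    have hev : f =ᶠ[nhds t] g ∘ F := by
      filter_upwards [(hFderiv t ht).continuousAt.preimage_mem_nhds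
        (isOpen_Ioo.mem_nhds (hmem t ht))] with s hs
      have hs' : s ∈ 𝓕 := by
        rw [h𝓕]
        exact hs
      rw [Function.comp_apply, hg _ hs, hFinv_left s hs']
    exact (hfderiv t ht).unique (hcomp.congr_of_eventuallyEq hev)
  have hintegrand : ∀ t ∈ 𝓕, |f t| • g' (F t) ^ 2 = f' t ^ 2 / f t := by
    intro t ht
    have hpos := hfpos t ht
    rw [hscore t ht, abs_of_pos hpos, smul_eq_mul]
    field_simp
  have hderivW : ∀ t ∈ 𝓕, HasDerivWithinAt F (f t) 𝓕 t :=
    fun t ht => (hFderiv t ht).hasDerivWithinAt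
  have hint : IntegrableOn (fun x => g' x ^ 2) (Set.Ioo 0 1) := by
    rw [← himage, integrableOn_image_iff_integrableOn_abs_deriv_smul h𝓕meas hderivW hinj]
    exact hFisher.congr_fun (fun t ht => (hintegrand t ht).symm) h𝓕meas
  have hinteq : ∫ x in Set.Ioo (0 : ℝ) 1, g' x ^ 2 = ∫ t in 𝓕, f' t ^ 2 / f t := by
    rw [← himage, integral_image_eq_integral_abs_deriv_smul h𝓕meas hderivW hinj]
    exact setIntegral_congr_fun h𝓕meas hintegrand
  have hc : ContinuousOn g' (Set.Ioo 0 1) :=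
    fun x hx => (hg'deriv x hx).continuousAt.continuousWithinAt
  have henergy := tendsto_discrete_energy hgderiv hc hint
  rw [hinteq] at henergy
  have hgrid : Tendsto (fun m : ℕ => 1 / ((m : ℝ) + 2)) atTop (nhdsWithin 0 (Set.Ioi 0)) := by
    refine tendsto_nhdsWithin_iff.2 ⟨?_, Eventually.of_forall fun m => ?_⟩
    · have h := (tendsto_add_atTop_iff_nat 2).2 (tendsto_one_div_atTop_nhds_zero_nat (𝕜 := ℝ))
      simpa using h
    · exact Set.mem_Ioi.2 (by positivity)
  have hboundary := hlim1.comp hgrid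
  rw [← tendsto_add_atTop_iff_nat 1, add_comm]
  refine (hboundary.add henergy).congr fun m => ?_
  let d : ℕ → ℝ := fun j => if 0 < j ∧ j < m + 2 then g ((j : ℝ) / (m + 2)) else 0
  have hdg : ∀ j ≤ m, d (j + 1) = g (((j : ℝ) + 1) / (m + 2)) := fun j hj => by
    simp only [d]
    rw [if_pos ⟨by omega, by omega⟩]
    push_cast
    rfl
  have hdf : ∀ j ≤ m, d (j + 1) = f (Finv (((j : ℝ) + 1) / (m + 2))) := fun j hj => by
    rw [hdg j hj, hg _ (grid_mem_Ioo hj)]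
  rw [ones_dotProduct_inv_bridge m d (by simp [d]) (by simp [d])
    (fun i hi => by
      rw [hdf i hi]
      exact (hfpos _ (hFinv_mem _ (grid_mem_Ioo hi))).ne') (H (m + 1)) (fun i j => by
      have e : ((m + 1 : ℕ) : ℝ) + 1 = m + 2 := by push_cast; ring
      rw [hH, e, hdf i (by omega), hdf j (by omega)])]
  have hn : (m : ℝ) + 2 ≠ 0 := by positivity
  congr 1
  · have h1 := hdg 0 (Nat.zero_le m)
    rw [hdg m le_rfl, h1, Function.comp_apply]
    have e : 1 - 1 / ((m : ℝ) + 2) = (m + 1) / (m + 2) := by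
      field_simp
      ring
    rw [e, one_div, inv_inv]
    simp
  · congr 1
    refine Finset.sum_congr rfl fun j hj => ?_
    have hj' := Finset.mem_range.1 hj
    have h2 := hdg (j + 1) hj'
    have e : ((j + 1 : ℕ) : ℝ) + 1 = j + 2 := by push_cast; ring
    rw [e] at h2
    rw [hdg j hj'.le, h2]
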